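/- (All cocycles on osp(1|2) ⊕ u(1) are coboundary.) Let δ : G → G⊗G be a linear map on the Lie superalgebra G = osp(1|2) ⊕ u(1) such that: (i) for every homogeneous x ∈ G of grade a, δ(x) lies in the sum of the subspaces G_b⊗G_c with b + c ≡ a (mod 2); (ii) δ takes values in graded-antisymmetric tensors, i.e. writing δ(gᵢ) = Σ f_i^{jk} g_j⊗g_k in the basis (g₁,…,g₆) = (H,X₊,X₋,Z,Q₊,Q₋), one has f_i^{jk} = −(−1)^{|j||k|} f_i^{kj}; (iii) δ is a 1-cocycle: δ(μ(x,y)) = x·δ(y) − (−1)^{|x||y|} y·δ(x) for all homogeneous x, y ∈ G. Then δ is coboundary: there exists an even, graded-antisymmetric element r ∈ G⊗G such that δ(x) = x·r for all x ∈ G. -/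

import Mathlib

noncomputable section

set_option linter.unusedSimpArgs false

open scoped BigOperators

/-- The underlying vector space of `osp(1|2) ⊕ u(1)`, with coordinates in the basis
`(g₀,…,g₅) = (H, X₊, X₋, Z, Q₊, Q₋)`. -/
abbrev G := Fin 6 → ℂ

/-- `G ⊗ G`, represented by coefficient matrices in the basis `gᵢ ⊗ gⱼ`. -/
abbrev TT := Fin 6 → Fin 6 → ℂ

/-- The grade: `H, X₊, X₋, Z` are even (0); `Q₊, Q₋` are odd (1). -/
def gr (i : Fin 6) : ℕ := if i.val < 4 then 0 else 1

/-- The sign `z(i,j) = (−1)^{|i||j|}`. -/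
def zz (i j : Fin 6) : ℂ := (-1 : ℂ) ^ (gr i * gr j)

/-- Structure constants of `osp(1|2) ⊕ u(1)` (on `ℕ` indices, 0 outside the table). -/
def cNat : ℕ → ℕ → ℕ → ℂ
  | 0,1,1 => 1 | 1,0,1 => -1
  | 0,2,2 => -1 | 2,0,2 => 1
  | 1,2,0 => -2 | 2,1,0 => 2
  | 0,4,4 => 1/2 | 4,0,4 => -1/2
  | 0,5,5 => -1/2 | 5,0,5 => 1/2
  | 1,5,4 => -1 | 5,1,4 => 1
  | 2,4,5 => 1 | 4,2,5 => -1
  | 4,5,0 => 1/2 | 5,4,0 => 1/2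
  | 4,4,1 => 1/2
  | 5,5,2 => 1/2
  | _,_,_ => 0

/-- Structure constants `c i j k`, so that `μ(gᵢ,gⱼ) = Σ_k c i j k • g_k`. -/
def c (i j k : Fin 6) : ℂ := cNat i.val j.val k.val

/-- The bracket `μ` of `osp(1|2) ⊕ u(1)`, extended bilinearly from the basis. -/
def mu (u v : G) : G := fun k => ∑ i, ∑ j, u i * v j * c i j k

/-- The basis vectors `g₀,…,g₅`. -/
def e (i : Fin 6) : G := Pi.single i 1

/-- Membership in the even part `G₀ = span{H, X₊, X₋, Z}`. -/
def isEven (v : G) : Prop := ∀ i : Fin 6, 4 ≤ i.val → v i = 0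

/-- Membership in the odd part `G₁ = span{Q₊, Q₋}`. -/
def isOdd (v : G) : Prop := ∀ i : Fin 6, i.val < 4 → v i = 0

/-- The action of the basis vector `gᵢ` on `G ⊗ G`:
`gᵢ·(u⊗v) = μ(gᵢ,u)⊗v + (−1)^{|i||u|} u⊗μ(gᵢ,v)`. -/
def actB (i : Fin 6) (r : TT) : TT :=
  fun p q => (∑ j, c i j p * r j q) + zz i p * ∑ j, c i j q * r p j

/-- The (bilinearly extended) action `x ↦ x·r` of `G` on `G ⊗ G`, as a linear map in `x`. -/
def actL (r : TT) : G →ₗ[ℂ] TT :=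
  ∑ i : Fin 6, LinearMap.smulRight (LinearMap.proj i : G →ₗ[ℂ] ℂ) (actB i r)

/-- weights of the basis vectors under `H` -/
def wt (i : Fin 6) : ℂ := c 0 i i

lemma c_zero (j p : Fin 6) : c 0 j p = if j = p then wt p else 0 := by
  fin_cases j <;> fin_cases p <;> simp [wt, c, cNat]

lemma zz_zero (p : Fin 6) : zz 0 p = 1 := by simp [zz, gr]

set_option maxHeartbeats 4000000 in
lemma c_wt (i j p : Fin 6) : c i j p * (wt p - wt i - wt j) = 0 := by
  fin_cases i <;> fin_cases j <;> fin_cases p <;> simp [wt, c, cNat] <;> norm_num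

lemma actB_zero (r : TT) (p q : Fin 6) : actB 0 r p q = (wt p + wt q) * r p q := by
  simp [actB, c_zero, zz_zero, add_mul]

/-- If `s` is `r` multiplied by weights, then so is the action. -/
lemma actB_wt (r s : TT) (h : ∀ p q, s p q = (wt p + wt q) * r p q) (i p q : Fin 6) :
    actB i s p q = (wt p + wt q - wt i) * actB i r p q := by
  unfold actB
  have h1 : (∑ j, c i j p * s j q) = (wt p + wt q - wt i) * ∑ j, c i j p * r j q := by
    rw [Finset.mul_sum]
    refine Finset.sum_congr rfl fun j _ => ?_
    rw [h]
    linear_combination (-r j q) * c_wt i j p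
  have h2 : (∑ j, c i j q * s p j) = (wt p + wt q - wt i) * ∑ j, c i j q * r p j := by
    rw [Finset.mul_sum]
    refine Finset.sum_congr rfl fun j _ => ?_
    rw [h]
    linear_combination (-r p j) * c_wt i j q
  rw [h1, h2]; ring

lemma actL_apply (r : TT) (x : G) : actL r x = ∑ i, x i • actB i r := by
  simp [actL]

lemma actL_e (r : TT) (i : Fin 6) : actL r (e i) = actB i r := by
  rw [actL_apply, Finset.sum_eq_single i] <;> simp +contextual [e]

lemma mu_e (i j : Fin 6) : mu (e i) (e j) = ∑ k, c i j k • e k := by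
  funext k
  simp [mu, e, Pi.single_apply, Finset.sum_apply]

lemma e_even (i : Fin 6) (h : i.val < 4) : isEven (e i) := by
  intro j hj
  have : j ≠ i := by rintro rfl; omega
  simp [e, this]

lemma e_odd (i : Fin 6) (h : 4 ≤ i.val) : isOdd (e i) := by
  intro j hj
  have : j ≠ i := by rintro rfl; omega
  simp [e, this]

lemma wt0 : wt 0 = 0 := rfl
lemma wt1 : wt 1 = 1 := rfl
lemma wt2 : wt 2 = -1 := rfl
lemma wt3 : wt 3 = 0 := rfl
lemma wt4 : wt 4 = 1/2 := rfl
lemma wt5 : wt 5 = -1/2 := rfl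

/-- the weight zero part of `r` -/
def rz (a b t : ℂ) : TT :=
  ![![0,0,0,-a,0,0],
    ![0,0,b/2,0,0,0],
    ![0,-b/2,0,0,0,0],
    ![a,0,0,0,0,0],
    ![0,0,0,0,0,-t/2],
    ![0,0,0,0,-t/2,0]]

set_option maxHeartbeats 4000000 in
/-- components of `δ` which preserve the weight -/
lemma matched (D : Fin 6 → TT)
    (hanti : ∀ i p q, D i p q = - zz p q * D i q p)
    (hcoc : ∀ i j p q, ∑ k, c i j k * D k p q =
      actB i (D j) p q - zz i j * actB j (D i) p q) (i p q : Fin 6)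
    (h : wt p + wt q - wt i = 0) :
    D i p q = actB i (rz (D 1 1 3) (D 1 0 1) (D 1 4 4)) p q := by
  have diag : ∀ i p, p.val < 4 → D i p p = 0 := by
    intro i p hp
    have := hanti i p p
    simp [zz, gr, hp] at this
    linear_combination this / 2
  have d0 := fun i => diag i 0 (by decide)
  have d1 := fun i => diag i 1 (by decide)
  have d2 := fun i => diag i 2 (by decide)
  have d3 := fun i => diag i 3 (by decide)
  have a10 : ∀ i, D i 1 0 = -D i 0 1 := fun i => by simpa [zz, gr] using hanti i 1 0
  have a20 : ∀ i, D i 2 0 = -D i 0 2 := fun i => by simpa [zz, gr] using hanti i 2 0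
  have a21 : ∀ i, D i 2 1 = -D i 1 2 := fun i => by simpa [zz, gr] using hanti i 2 1
  have a30 : ∀ i, D i 3 0 = -D i 0 3 := fun i => by simpa [zz, gr] using hanti i 3 0
  have a31 : ∀ i, D i 3 1 = -D i 1 3 := fun i => by simpa [zz, gr] using hanti i 3 1
  have a32 : ∀ i, D i 3 2 = -D i 2 3 := fun i => by simpa [zz, gr] using hanti i 3 2
  have a40 : ∀ i, D i 4 0 = -D i 0 4 := fun i => by simpa [zz, gr] using hanti i 4 0
  have a41 : ∀ i, D i 4 1 = -D i 1 4 := fun i => by simpa [zz, gr] using hanti i 4 1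
  have a42 : ∀ i, D i 4 2 = -D i 2 4 := fun i => by simpa [zz, gr] using hanti i 4 2
  have a43 : ∀ i, D i 4 3 = -D i 3 4 := fun i => by simpa [zz, gr] using hanti i 4 3
  have a50 : ∀ i, D i 5 0 = -D i 0 5 := fun i => by simpa [zz, gr] using hanti i 5 0
  have a51 : ∀ i, D i 5 1 = -D i 1 5 := fun i => by simpa [zz, gr] using hanti i 5 1
  have a52 : ∀ i, D i 5 2 = -D i 2 5 := fun i => by simpa [zz, gr] using hanti i 5 2
  have a53 : ∀ i, D i 5 3 = -D i 3 5 := fun i => by simpa [zz, gr] using hanti i 5 3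
  have a54 : ∀ i, D i 5 4 = D i 4 5 := fun i => by simpa [zz, gr] using hanti i 5 4
  clear hanti diag
  have f012 : D 0 1 2 = 0 := by
    have h := hcoc 0 1 0 1
    simp [actB, Fin.sum_univ_six, c, cNat, zz, gr, d0, d1, d2, d3, a10, a20, a21, a30, a31, a32, a40, a41, a42, a43, a50, a51, a52, a53, a54] at h
    grind
  have f003 : D 0 0 3 = 0 := by
    have h := hcoc 0 1 1 3
    simp [actB, Fin.sum_univ_six, c, cNat, zz, gr, d0, d1, d2, d3, a10, a20, a21, a30, a31, a32, a40, a41, a42, a43, a50, a51, a52, a53, a54] at h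
    grind
  have f045 : D 0 4 5 = 0 := by
    have h := hcoc 0 1 4 4
    simp [actB, Fin.sum_univ_six, c, cNat, zz, gr, d0, d1, d2, d3, a10, a20, a21, a30, a31, a32, a40, a41, a42, a43, a50, a51, a52, a53, a54] at h
    grind
  have f312 : D 3 1 2 = 0 := by
    have h := hcoc 1 3 0 1
    simp [actB, Fin.sum_univ_six, c, cNat, zz, gr, d0, d1, d2, d3, a10, a20, a21, a30, a31, a32, a40, a41, a42, a43, a50, a51, a52, a53, a54] at h
    grind
  have f303 : D 3 0 3 = 0 := by
    have h := hcoc 1 3 1 3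
    simp [actB, Fin.sum_univ_six, c, cNat, zz, gr, d0, d1, d2, d3, a10, a20, a21, a30, a31, a32, a40, a41, a42, a43, a50, a51, a52, a53, a54] at h
    grind
  have f345 : D 3 4 5 = 0 := by
    have h := hcoc 1 3 4 4
    simp [actB, Fin.sum_univ_six, c, cNat, zz, gr, d0, d1, d2, d3, a10, a20, a21, a30, a31, a32, a40, a41, a42, a43, a50, a51, a52, a53, a54] at h
    grind
  have f434 : D 4 3 4 = -D 1 1 3/2 := by
    have h := hcoc 4 4 1 3
    simp [actB, Fin.sum_univ_six, c, cNat, zz, gr, d0, d1, d2, d3, a10, a20, a21, a30, a31, a32, a40, a41, a42, a43, a50, a51, a52, a53, a54] at h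
    grind
  have f535 : D 5 3 5 = D 1 1 3/2 := by
    have h := hcoc 1 5 3 4
    simp [actB, Fin.sum_univ_six, c, cNat, zz, gr, d0, d1, d2, d3, a10, a20, a21, a30, a31, a32, a40, a41, a42, a43, a50, a51, a52, a53, a54] at h
    grind
  have f223 : D 2 2 3 = -D 1 1 3 := by
    have h := hcoc 5 5 2 3
    simp [actB, Fin.sum_univ_six, c, cNat, zz, gr, d0, d1, d2, d3, a10, a20, a21, a30, a31, a32, a40, a41, a42, a43, a50, a51, a52, a53, a54] at h
    grind
  have f404 : D 4 0 4 = -D 1 4 4/4 := by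
    have h := hcoc 4 4 4 4
    simp [actB, Fin.sum_univ_six, c, cNat, zz, gr, d0, d1, d2, d3, a10, a20, a21, a30, a31, a32, a40, a41, a42, a43, a50, a51, a52, a53, a54] at h
    grind
  have f415 : D 4 1 5 = -D 1 4 4/4-D 1 0 1/2 := by
    have h := hcoc 4 4 0 1
    simp [actB, Fin.sum_univ_six, c, cNat, zz, gr, d0, d1, d2, d3, a10, a20, a21, a30, a31, a32, a40, a41, a42, a43, a50, a51, a52, a53, a54] at h
    grind
  have f505 : D 5 0 5 = -D 1 4 4/4 := by
    have h := hcoc 1 5 1 5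
    simp [actB, Fin.sum_univ_six, c, cNat, zz, gr, d0, d1, d2, d3, a10, a20, a21, a30, a31, a32, a40, a41, a42, a43, a50, a51, a52, a53, a54] at h
    grind
  have f255 : D 2 5 5 = -D 1 4 4 := by
    have h := hcoc 5 5 5 5
    simp [actB, Fin.sum_univ_six, c, cNat, zz, gr, d0, d1, d2, d3, a10, a20, a21, a30, a31, a32, a40, a41, a42, a43, a50, a51, a52, a53, a54] at h
    grind
  have f202 : D 2 0 2 = D 1 0 1 := by
    have h := hcoc 1 2 1 2
    simp [actB, Fin.sum_univ_six, c, cNat, zz, gr, d0, d1, d2, d3, a10, a20, a21, a30, a31, a32, a40, a41, a42, a43, a50, a51, a52, a53, a54] at h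
    grind
  have f524 : D 5 2 4 = -D 1 4 4/4-D 1 0 1/2 := by
    have h := hcoc 5 5 0 2
    simp [actB, Fin.sum_univ_six, c, cNat, zz, gr, d0, d1, d2, d3, a10, a20, a21, a30, a31, a32, a40, a41, a42, a43, a50, a51, a52, a53, a54] at h
    grind
  clear hcoc
  fin_cases i <;> fin_cases p <;> fin_cases q <;>
  first
  | (exfalso; norm_num [wt, c, cNat] at h; done)
  | (clear h
     simp [actB, rz, Fin.sum_univ_six, c, cNat, zz, gr, d0, d1, d2, d3, a10, a20, a21, a30, a31, a32, a40, a41, a42, a43, a50, a51, a52, a53, a54, f012, f003, f045, f312, f303, f345, f434, f535, f223, f404, f415, f505, f255, f202, f524] <;> ring)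

/-- the candidate `r` -/
def rr (D : Fin 6 → TT) : TT := fun p q =>
  rz (D 1 1 3) (D 1 0 1) (D 1 4 4) p q + D 0 p q / (wt p + wt q)

lemma rz_wt (a b t : ℂ) (p q : Fin 6) : (wt p + wt q) * rz a b t p q = 0 := by
  fin_cases p <;> fin_cases q <;> simp [rz, wt0, wt1, wt2, wt3, wt4, wt5] <;> norm_num

lemma rz_anti (a b t : ℂ) (p q : Fin 6) : rz a b t p q = - zz p q * rz a b t q p := by
  fin_cases p <;> fin_cases q <;> simp [rz, zz, gr] <;> ring

lemma rz_even (a b t : ℂ) (p q : Fin 6) (h : gr p ≠ gr q) : rz a b t p q = 0 := by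
  revert h
  fin_cases p <;> fin_cases q <;> simp [rz, gr]

lemma actB_congr_wt (r s : TT) (i p q : Fin 6) (hm : wt p + wt q - wt i = 0)
    (h : ∀ p q, wt p + wt q = 0 → r p q = s p q) : actB i r p q = actB i s p q := by
  unfold actB
  congr 1
  · refine Finset.sum_congr rfl fun j _ => ?_
    rcases mul_eq_zero.1 (c_wt i j p) with h0 | h0
    · simp [h0]
    · rw [h j q (by linear_combination hm - h0)]
  · congr 1
    refine Finset.sum_congr rfl fun j _ => ?_
    rcases mul_eq_zero.1 (c_wt i j q) with h0 | h0
    · simp [h0]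
    · rw [h p j (by linear_combination hm - h0)]

lemma core (D : Fin 6 → TT)
    (hanti : ∀ i p q, D i p q = - zz p q * D i q p)
    (hcoc : ∀ i j p q, ∑ k, c i j k * D k p q =
      actB i (D j) p q - zz i j * actB j (D i) p q) (i p q : Fin 6) :
    D i p q = actB i (rr D) p q := by
  by_cases hm : wt p + wt q - wt i = 0
  · rw [matched D hanti hcoc i p q hm]
    refine actB_congr_wt _ _ i p q hm fun p q h => ?_
    simp [rr, h]
  · have h0 : ∀ p q, D 0 p q = (wt p + wt q) * rr D p q := by
      intro p q
      by_cases h : wt p + wt q = 0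
      · have := matched D hanti hcoc 0 p q (by rw [h, wt0]; simp)
        rw [actB_zero] at this
        rw [this, h]; simp
      · rw [rr, mul_add, rz_wt]
        field_simp
        simp
    have h1 := actB_wt (rr D) (D 0) h0 i p q
    have h2 := hcoc 0 i p q
    rw [actB_zero, zz_zero] at h2
    simp only [c_zero, ite_mul, zero_mul, Finset.sum_ite_eq, Finset.mem_univ, if_true] at h2
    refine mul_left_cancel₀ hm ?_
    linear_combination h1 - h2

/-- every parity-respecting, graded-antisymmetric 1-cocycle
`δ : G → G⊗G` on `osp(1|2) ⊕ u(1)` is a coboundary `δ(x) = x·r` for some even,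
graded-antisymmetric `r ∈ G⊗G`. -/
theorem stmt18 (δ : G →ₗ[ℂ] TT)
    (hpar0 : ∀ x, isEven x → ∀ p q : Fin 6, (gr p + gr q) % 2 = 1 → δ x p q = 0)
    (hpar1 : ∀ x, isOdd x → ∀ p q : Fin 6, (gr p + gr q) % 2 = 0 → δ x p q = 0)
    (hanti : ∀ i j k : Fin 6, δ (e i) j k = - zz j k * δ (e i) k j)
    (hcoc1 : ∀ x y, (isEven x ∨ isEven y) → δ (mu x y) = actL (δ y) x - actL (δ x) y)
    (hcoc2 : ∀ x y, isOdd x → isOdd y → δ (mu x y) = actL (δ y) x + actL (δ x) y) :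
    ∃ r : TT, (∀ p q : Fin 6, gr p ≠ gr q → r p q = 0) ∧
      (∀ p q : Fin 6, r p q = - zz p q * r q p) ∧
      ∀ x : G, δ x = actL r x := by
  have hc : ∀ i j p q, ∑ k, c i j k * δ (e k) p q =
      actB i (δ (e j)) p q - zz i j * actB j (δ (e i)) p q := by
    intro i j p q
    have hl : ∑ k, c i j k * δ (e k) p q = δ (mu (e i) (e j)) p q := by
      rw [mu_e]; simp [Finset.sum_apply]
    rw [hl]
    by_cases hi : i.val < 4
    · rw [hcoc1 _ _ (Or.inl (e_even i hi)), actL_e, actL_e]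
      simp [zz, gr, hi]
    · by_cases hj : j.val < 4
      · rw [hcoc1 _ _ (Or.inr (e_even j hj)), actL_e, actL_e]
        simp [zz, gr, hj]
      · rw [hcoc2 _ _ (e_odd i (by omega)) (e_odd j (by omega)), actL_e, actL_e]
        simp [zz, gr, hi, hj]
  have hcore := core (fun i => δ (e i)) hanti hc
  refine ⟨rr (fun i => δ (e i)), ?_, ?_, ?_⟩
  · intro p q h
    rw [rr, rz_even _ _ _ p q h]
    have : δ (e 0) p q = 0 := by
      apply hpar0 _ (e_even 0 (by decide))
      have hp : gr p = 0 ∨ gr p = 1 := by unfold gr; split_ifs <;> simp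
      have hq : gr q = 0 ∨ gr q = 1 := by unfold gr; split_ifs <;> simp
      omega
    simp [this]
  · intro p q
    rw [rr, rr, rz_anti, hanti 0 p q, add_comm (wt p)]
    ring
  · intro x
    have hx : x = ∑ i, x i • e i := by
      funext k
      simp [e, Finset.sum_apply, Pi.single_apply]
    rw [actL_apply]
    conv_lhs => rw [hx]
    rw [map_sum]
    refine Finset.sum_congr rfl fun i _ => ?_
    rw [map_smul]
    congr 1
    funext p q
    exact hcore i p q

end
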